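/- One has limsup_{n→∞} log(e_{⌊log n⌋}(n))/log(n) ≥ 1, where the limit superior is taken over positive integers n (with n large enough that ⌊log n⌋ ≥ 1). -/

import Mathlib

open Filter

/-- A finite subset `S` of the `n`-dimensional hypercube (binary sequences of
length `n`) is `d`-equilateral if it is nonempty and any two distinct points
have Hamming distance exactly `d`. -/
def IsEquilateralSet {n : ℕ} (d : ℕ) (S : Finset (Fin n → Bool)) : Prop :=
  S.Nonempty ∧ ∀ x ∈ S, ∀ y ∈ S, x ≠ y → hammingDist x y = d

/-- `equilateralDim d n` is the maximal size of a `d`-equilateral subset of the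
`n`-dimensional hypercube. -/
noncomputable def equilateralDim (d n : ℕ) : ℕ :=
  sSup {m : ℕ | ∃ S : Finset (Fin n → Bool), IsEquilateralSet d S ∧ S.card = m}

/-- The indicator vectors `(i, b) ↦ [x i = b]` of two points of the hypercube have inner product
`n` minus their Hamming distance. -/
theorem sum_indicator_mul_indicator {n : ℕ} (x y : Fin n → Bool) :
    ∑ p : Fin n × Bool, (if x p.1 = p.2 then (1 : ℝ) else 0) * (if y p.1 = p.2 then 1 else 0)
      = n - hammingDist x y := by
  have h : ∀ i, ∑ b : Bool, (if x i = b then (1 : ℝ) else 0) * (if y i = b then 1 else 0)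
      = 1 - if x i ≠ y i then 1 else 0 := by
    intro i
    cases x i <;> cases y i <;> simp
  rw [Fintype.sum_prod_type]
  simp only [h, Finset.sum_sub_distrib, hammingDist, Finset.sum_boole]
  simp

theorem IsEquilateralSet.card_le {n d : ℕ} (hn : 1 ≤ n) {S : Finset (Fin n → Bool)}
    (hS : IsEquilateralSet d S) : S.card ≤ 2 * n := by
  rcases Nat.lt_or_ge 1 S.card with h1 | h1
  swap
  · omega
  obtain ⟨a, ha, b, hb, hab⟩ := Finset.one_lt_card.1 h1
  have hd : hammingDist a b = d := hS.2 a ha b hb hab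
  have hd0 : (0 : ℝ) < d := by
    rw [← hd]; exact_mod_cast hammingDist_pos.2 hab
  have hdn : (d : ℝ) ≤ n := by
    rw [← hd]; exact_mod_cast (by simpa using hammingDist_le_card_fintype (x := a) (y := b))
  let w : S → Fin n × Bool → ℝ := fun x p => if x.1 p.1 = p.2 then 1 else 0
  have hw : ∀ x y : S, ∑ p, w x p * w y p = (n - d) + if x = y then (d : ℝ) else 0 := by
    intro x y
    refine (sum_indicator_mul_indicator x.1 y.1).trans ?_
    split_ifs with hxy
    · simp [hxy]
    · rw [hS.2 x.1 x.2 y.1 y.2 (fun h => hxy (Subtype.ext h))]; simp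
  have hli : LinearIndependent ℝ w := by
    rw [Fintype.linearIndependent_iff]
    intro c hc
    have key : ∑ p, (∑ x, c x * w x p) ^ 2
        = (n - d) * (∑ x, c x) ^ 2 + d * ∑ x, c x ^ 2 := by
      calc ∑ p, (∑ x, c x * w x p) ^ 2
          = ∑ p, ∑ x, ∑ y, c x * c y * (w x p * w y p) := by
            refine Finset.sum_congr rfl fun p _ => ?_
            rw [sq, Finset.sum_mul_sum]
            exact Finset.sum_congr rfl fun x _ => Finset.sum_congr rfl fun y _ => by ring
        _ = ∑ x, ∑ y, c x * c y * ∑ p, w x p * w y p := by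
            rw [Finset.sum_comm]
            refine Finset.sum_congr rfl fun x _ => ?_
            rw [Finset.sum_comm]
            simp only [Finset.mul_sum]
        _ = (n - d) * (∑ x, c x) ^ 2 + d * ∑ x, c x ^ 2 := by
            simp only [hw, mul_add, Finset.sum_add_distrib, mul_ite, mul_zero,
              Finset.sum_ite_eq, Finset.mem_univ, if_true]
            congr 1
            · rw [sq, Finset.sum_mul_sum, Finset.mul_sum]
              simp only [Finset.mul_sum]
              exact Finset.sum_congr rfl fun x _ => Finset.sum_congr rfl fun y _ => by ring
            · rw [Finset.mul_sum]
              exact Finset.sum_congr rfl fun x _ => by ring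
    have hzero : ∑ p, (∑ x, c x * w x p) ^ 2 = 0 := by
      refine Finset.sum_eq_zero fun p _ => ?_
      have := congrFun hc p
      simp only [Finset.sum_apply, Pi.smul_apply, smul_eq_mul, Pi.zero_apply] at this
      rw [this]; simp
    have hsq : ∑ x, c x ^ 2 = 0 := by
      have h₁ : 0 ≤ ∑ x, c x ^ 2 := Finset.sum_nonneg fun x _ => sq_nonneg _
      have h₂ : 0 ≤ ((n : ℝ) - d) * (∑ x, c x) ^ 2 :=
        mul_nonneg (sub_nonneg.2 hdn) (sq_nonneg _)
      nlinarith
    intro x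
    have := (Finset.sum_eq_zero_iff_of_nonneg fun x _ => sq_nonneg (c x)).1 hsq x
      (Finset.mem_univ x)
    exact pow_eq_zero_iff two_ne_zero |>.1 this
  have := hli.fintype_card_le_finrank
  simp at this
  omega

theorem equilateralDim_le {d n : ℕ} (hn : 1 ≤ n) : equilateralDim d n ≤ 2 * n := by
  refine csSup_le' ?_
  rintro m ⟨S, hS, rfl⟩
  exact hS.card_le hn

theorem IsEquilateralSet.card_le_equilateralDim {n d : ℕ} {S : Finset (Fin n → Bool)}
    (hS : IsEquilateralSet d S) : S.card ≤ equilateralDim d n := by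
  refine le_csSup ⟨Fintype.card (Fin n → Bool), ?_⟩ ⟨S, hS, rfl⟩
  rintro m ⟨T, -, rfl⟩
  exact T.card_le_univ

/-- The indicators of `m` pairwise disjoint `k`-element subsets form a `2 * k`-equilateral set. -/
theorem le_equilateralDim_two_mul {n k m : ℕ} (hk : 1 ≤ k) (h : m * k ≤ n) :
    m ≤ equilateralDim (2 * k) n := by
  rcases Nat.eq_zero_or_pos m with rfl | hm
  · exact Nat.zero_le _
  obtain ⟨f⟩ : Nonempty (Fin m × Fin k ↪ Fin n) :=
    Function.Embedding.nonempty_of_card_le (by simpa using h)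
  let A : Fin m → Finset (Fin n) := fun j => Finset.univ.image fun i : Fin k => f (j, i)
  let v : Fin m → Fin n → Bool := fun j i => decide (i ∈ A j)
  have hcard : ∀ j, (A j).card = k := fun j => by
    rw [Finset.card_image_of_injective _ fun i i' hi => by simpa using hi]
    simp
  have hdisj : ∀ j l, j ≠ l → Disjoint (A j) (A l) := by
    intro j l hjl
    rw [Finset.disjoint_left]
    intro i hi hi'
    simp only [A, Finset.mem_image, Finset.mem_univ, true_and] at hi hi'
    obtain ⟨a, rfl⟩ := hi
    obtain ⟨b, hb⟩ := hi'
    have := f.injective hb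
    simp only [Prod.mk.injEq] at this
    exact hjl this.1.symm
  have hdist : ∀ j l, j ≠ l → hammingDist (v j) (v l) = 2 * k := by
    intro j l hjl
    have hset : (Finset.univ.filter fun i => v j i ≠ v l i) = A j ∪ A l := by
      ext i
      have : i ∈ A j → i ∉ A l := fun hi =>
        Finset.disjoint_left.1 (hdisj j l hjl) hi
      simp only [v, Finset.mem_filter, Finset.mem_univ, true_and, Finset.mem_union, ne_eq,
        decide_eq_decide]
      tauto
    rw [hammingDist, hset, Finset.card_union_of_disjoint (hdisj j l hjl), hcard, hcard]
    ring
  have hinj : Function.Injective v := by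
    intro j l hv
    by_contra hjl
    have := hdist j l hjl
    rw [hv, hammingDist_self] at this
    omega
  have hS : IsEquilateralSet (2 * k) (Finset.univ.image v) := by
    refine ⟨⟨v ⟨0, hm⟩, Finset.mem_image_of_mem _ (Finset.mem_univ _)⟩, ?_⟩
    intro x hx y hy hxy
    obtain ⟨j, -, rfl⟩ := Finset.mem_image.1 hx
    obtain ⟨l, -, rfl⟩ := Finset.mem_image.1 hy
    exact hdist j l fun h => hxy (h ▸ rfl)
  have := hS.card_le_equilateralDim
  rwa [Finset.card_image_of_injective _ hinj, Finset.card_univ, Fintype.card_fin] at this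

theorem div_log_le_equilateralDim {n k : ℕ} (hk : 1 ≤ k) (hn : ⌊Real.log n⌋₊ = 2 * k) :
    n / Real.log n ≤ equilateralDim ⌊Real.log n⌋₊ n := by
  have hlog : (2 * k : ℝ) ≤ Real.log n := by
    have := Nat.floor_le (Real.log_natCast_nonneg n)
    rw [hn] at this
    exact_mod_cast this
  have hk' : (1 : ℝ) ≤ k := by exact_mod_cast hk
  have hkn : (2 * k : ℝ) ≤ n :=
    hlog.trans (Real.log_le_self (Nat.cast_nonneg n))
  have hm : n / k ≤ equilateralDim ⌊Real.log n⌋₊ n := by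
    rw [hn]
    exact le_equilateralDim_two_mul hk (Nat.div_mul_le_self n k)
  have hfloor : (n / k : ℝ) < (n / k : ℕ) + 1 := by
    rw [← Nat.floor_div_eq_div (K := ℝ)]
    exact Nat.lt_floor_add_one _
  have hhalf : (n / k : ℝ) = 2 * (n / (2 * k)) := by field_simp
  have hone : (1 : ℝ) ≤ n / (2 * k) := by rwa [one_le_div (by positivity)]
  calc (n : ℝ) / Real.log n ≤ n / (2 * k) := by gcongr
    _ ≤ (n / k : ℕ) := by linarith
    _ ≤ _ := by exact_mod_cast hm

theorem frequently_floor_log_even :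
    ∃ᶠ n : ℕ in atTop, ∃ k, 1 ≤ k ∧ ⌊Real.log n⌋₊ = 2 * k := by
  rw [frequently_atTop]
  intro N
  let k := N + 1
  have hexp : (2 * k : ℝ) + 1 ≤ Real.exp (2 * k) := Real.add_one_le_exp _
  have hle : Real.exp (2 * k) ≤ ⌈Real.exp (2 * k)⌉₊ := Nat.le_ceil _
  have hlt := Nat.ceil_lt_add_one (Real.exp_pos (2 * k)).le
  have hk : (k : ℝ) = N + 1 := by simp [k]
  have hN : (0 : ℝ) ≤ N := Nat.cast_nonneg N
  have hpos : (0 : ℝ) < ⌈Real.exp (2 * k)⌉₊ := (Real.exp_pos _).trans_le hle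
  refine ⟨⌈Real.exp (2 * k)⌉₊, ?_, k, by omega, ?_⟩
  · have : (N : ℝ) ≤ ⌈Real.exp (2 * k)⌉₊ := by linarith
    exact_mod_cast this
  · rw [Nat.floor_eq_iff (Real.log_natCast_nonneg _)]
    push_cast
    refine ⟨(Real.le_log_iff_exp_le hpos).2 hle, (Real.log_lt_iff_lt_exp hpos).2 ?_⟩
    rw [Real.exp_add]
    nlinarith [Real.add_one_le_exp (1 : ℝ)]

theorem limsup_equilateralDim_log :
    1 ≤ limsup (fun n : ℕ =>
        Real.log (equilateralDim ⌊Real.log n⌋₊ n) / Real.log n) atTop := by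
  have hbdd : IsBoundedUnder (· ≤ ·) atTop (fun n : ℕ =>
      Real.log (equilateralDim ⌊Real.log n⌋₊ n) / Real.log n) := by
    refine isBoundedUnder_of_eventually_le (a := 2) ?_
    filter_upwards [eventually_ge_atTop 2] with n hn
    have hn' : (2 : ℝ) ≤ n := by exact_mod_cast hn
    rw [div_le_iff₀ (Real.log_pos (by linarith))]
    rcases Nat.eq_zero_or_pos (equilateralDim ⌊Real.log n⌋₊ n) with h0 | hpos
    · rw [h0]
      simpa using Real.log_natCast_nonneg n
    · have h2 : (equilateralDim ⌊Real.log n⌋₊ n : ℝ) ≤ 2 * n := by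
        exact_mod_cast equilateralDim_le (by omega)
      calc Real.log (equilateralDim ⌊Real.log n⌋₊ n) ≤ Real.log ((n : ℝ) ^ 2) :=
            Real.log_le_log (by exact_mod_cast hpos) (by nlinarith)
        _ = 2 * Real.log n := by rw [Real.log_pow]; norm_num
  have hlog : Tendsto (fun n : ℕ => Real.log n) atTop atTop :=
    Real.tendsto_log_atTop.comp tendsto_natCast_atTop_atTop
  refine le_of_forall_pos_sub_le fun ε hε => ?_
  refine le_limsup_of_frequently_le ?_ hbdd
  have hsmall : ∀ᶠ n : ℕ in atTop, Real.log (Real.log n) ≤ ε * Real.log n := by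
    filter_upwards [hlog.eventually (Real.isLittleO_log_id_atTop.bound hε),
      hlog.eventually_ge_atTop 0] with n h h0
    have := (le_abs_self _).trans h
    simpa [abs_of_nonneg h0] using this
  refine (frequently_floor_log_even.and_eventually
    (hsmall.and (hlog.eventually_gt_atTop 0))).mono ?_
  rintro n ⟨⟨k, hk, hn⟩, hsmall, hpos⟩
  have hn0 : (0 : ℝ) < n := by
    refine (Nat.cast_nonneg n).lt_of_ne fun h => ?_
    rw [← h, Real.log_zero] at hpos
    exact hpos.false
  have := Real.log_le_log (div_pos hn0 hpos) (div_log_le_equilateralDim hk hn)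
  rw [Real.log_div hn0.ne' hpos.ne'] at this
  rw [le_div_iff₀ hpos]
  linarith
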